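/- Assume in addition p > r!. For every nonzero prime ideal 𝔩 of A with 𝔩 ≠ (T), there do not exist a nondegenerate symmetric bilinear form β : φ[𝔩] × φ[𝔩] → 𝔽_𝔩 and a function λ : Gal(F̄/F) → 𝔽_𝔩^× such that β(σ(v), σ(w)) = λ(σ)·β(v, w) for all σ ∈ Gal(F̄/F) and all v, w ∈ φ[𝔩]. (The mod 𝔩 Galois image does not preserve any nondegenerate quadratic form on φ[𝔩] up to scalar multiplication.) -/

import Mathlib

open Polynomial

noncomputable section

/-- `F̄`: a fixed algebraic closure of `F = 𝔽_q(T)`. -/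
abbrev Kbar (Fq : Type) [Field Fq] := AlgebraicClosure (RatFunc Fq)

/-- `φ` is (encodes) the rank-`r` Drinfeld `𝔽_q[T]`-module over `𝔽_q(T)` given by
`φ_T = T + τ^{r-1} + T^{q-1} τ^r`: it is a ring homomorphism from `A = 𝔽_q[T]` to the
additive endomorphisms of `F̄` which is `𝔽_q`-linear (the condition on `C c`) and sends
`T` to `x ↦ T·x + x^{q^{r-1}} + T^{q-1}·x^{q^r}`. -/
def IsDrinfeldPhi (Fq : Type) [Field Fq] (q r : ℕ)
    (φ : Polynomial Fq →+* AddMonoid.End (Kbar Fq)) : Prop :=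
  (∀ (c : Fq) (x : Kbar Fq),
      φ (C c) x = algebraMap (RatFunc Fq) (Kbar Fq) (RatFunc.C c) * x) ∧
  (∀ x : Kbar Fq, φ X x =
      algebraMap (RatFunc Fq) (Kbar Fq) RatFunc.X * x + x ^ q ^ (r - 1) +
        algebraMap (RatFunc Fq) (Kbar Fq) RatFunc.X ^ (q - 1) * x ^ q ^ r)

/-- The `a`-torsion `φ[a] ⊆ F̄`. -/
def phiTorsion (Fq : Type) [Field Fq] (φ : Polynomial Fq →+* AddMonoid.End (Kbar Fq))
    (a : Polynomial Fq) : Set (Kbar Fq) := {x | φ a x = 0}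

/-- `g` is an `A/(a)`-module automorphism of `φ[a]`: a bijection of `φ[a]` with itself
which is additive and commutes with the `A`-action through `φ`. -/
def IsTorsionAut (Fq : Type) [Field Fq] (φ : Polynomial Fq →+* AddMonoid.End (Kbar Fq))
    (a : Polynomial Fq) (g : Kbar Fq → Kbar Fq) : Prop :=
  Set.BijOn g (phiTorsion Fq φ a) (phiTorsion Fq φ a) ∧
  (∀ x ∈ phiTorsion Fq φ a, ∀ y ∈ phiTorsion Fq φ a, g (x + y) = g x + g y) ∧
  (∀ b : Polynomial Fq, ∀ x ∈ phiTorsion Fq φ a, g (φ b x) = φ b (g x))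

open IsDedekindDomain WithZero in
theorem exists_valuation_and_inertia_element {A F K : Type*} [CommRing A] [IsDedekindDomain A]
    [Field F] [Field K] [Algebra A F] [IsFractionRing A F] [Algebra F K] [Algebra A K]
    [IsScalarTower A F K] [FiniteDimensional F K] [IsGalois F K]
    (t : A) (ht : Prime t) [Finite (A ⧸ Ideal.span {t})] {p : ℕ} (hp : p.Prime) :
    ∃ v : Valuation K ℤᵐ⁰, (∀ a, v (algebraMap A K a) ≤ 1) ∧ v (algebraMap A K t) < 1 ∧
      ∀ (y : K) (n : ℕ), p ∣ n → v (algebraMap A K t) * v y ^ n = 1 →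
        ∃ σ : K ≃ₐ[F] K, orderOf σ = p ∧ ∀ x, v x ≤ 1 → v (σ x - x) < 1 := by
  have := integralClosure.isDedekindDomain A F K
  have : Module.Finite A (integralClosure A K) := IsIntegralClosure.finite A F K _
  have : IsFractionRing (integralClosure A K) K :=
    integralClosure.isFractionRing_of_finite_extension F K
  let : MulSemiringAction (K ≃ₐ[F] K) (integralClosure A K) :=
    IsIntegralClosure.MulSemiringAction A F K _
  have hcomm (σ : K ≃ₐ[F] K) (b : integralClosure A K) :
      algebraMap (integralClosure A K) K (σ • b) = σ (algebraMap (integralClosure A K) K b) :=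
    algebraMap_galRestrict_apply A σ b
  have hG : IsGaloisGroup (K ≃ₐ[F] K) A (integralClosure A K) :=
    IsGaloisGroup.of_isFractionRing _ _ _ F K
  have hspan : (Ideal.span {t}).IsPrime := (Ideal.span_singleton_prime ht.ne_zero).2 ht
  let P : HeightOneSpectrum A := ⟨Ideal.span {t}, hspan, by simpa using ht.ne_zero⟩
  have hPmax : P.asIdeal.IsMaximal := P.isMaximal
  have : Finite (A ⧸ P.asIdeal) := ‹Finite (A ⧸ Ideal.span {t})›
  have : Finite P.asIdeal.ResidueField :=
    .of_surjective _ P.asIdeal.bijective_algebraMap_quotient_residueField.surjective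
  have : FaithfulSMul A K := (faithfulSMul_iff_algebraMap_injective A K).2 <| by
    rw [IsScalarTower.algebraMap_eq A F K]
    exact (algebraMap F K).injective.comp (IsFractionRing.injective A F)
  have : FaithfulSMul A (integralClosure A K) :=
    (faithfulSMul_iff_algebraMap_injective A _).2 <|
      .of_comp (f := algebraMap (integralClosure A K) K) (FaithfulSMul.algebraMap_injective A K)
  obtain ⟨M, hM, hlies⟩ :=
    Ideal.exists_maximal_ideal_liesOver_of_isIntegral (S := integralClosure A K) P.asIdeal
  let w : HeightOneSpectrum (integralClosure A K) :=
    ⟨M, hM.isPrime, Ideal.ne_bot_of_liesOver_of_ne_bot P.ne_bot M⟩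
  have : w.asIdeal.LiesOver P.asIdeal := hlies
  have hmap (a : A) : algebraMap A K a =
      algebraMap (integralClosure A K) K (algebraMap A (integralClosure A K) a) := rfl
  have hvt : w.valuation K (algebraMap A K t) =
      exp (-(P.asIdeal.ramificationIdx' w.asIdeal : ℤ)) := by
    rw [IsScalarTower.algebraMap_apply A F K, ← HeightOneSpectrum.valuation_liesOver K P w,
      HeightOneSpectrum.valuation_of_algebraMap,
      HeightOneSpectrum.intValuation_singleton P ht.ne_zero rfl, ← exp_nsmul]
    simp
  have he := Ideal.IsDedekindDomain.ramificationIdx'_ne_zero_of_liesOver w.asIdeal P.ne_bot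
  refine ⟨w.valuation K, fun a ↦ ?_, ?_, fun y n hpn hy ↦ ?_⟩
  · rw [hmap]; exact w.valuation_le_one _
  · rw [hvt, ← exp_zero, exp_lt_exp]; omega
  · have hdvd : p ∣ P.asIdeal.ramificationIdx' w.asIdeal := by
      obtain ⟨k, rfl⟩ := hpn
      have hy0 : w.valuation K y ≠ 0 := by
        intro h0
        rcases Nat.eq_zero_or_pos (p * k) with h | h
        · rw [h, pow_zero, mul_one, hvt, ← exp_zero, exp_inj] at hy
          omega
        · simp [h0, zero_pow h.ne'] at hy
      rw [hvt, ← exp_log hy0, ← exp_nsmul, ← exp_add, ← exp_zero, exp_inj] at hy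
      rw [← Int.natCast_dvd_natCast]
      refine ⟨k * log (w.valuation K y), ?_⟩
      simp only [nsmul_eq_mul] at hy
      push_cast at hy
      linarith
    have hcard : Nat.card (w.asIdeal.inertia (K ≃ₐ[F] K)) =
        P.asIdeal.ramificationIdx' w.asIdeal := by
      rw [Ideal.card_inertia_eq_ramificationIdxIn P.asIdeal w.asIdeal,
        Ideal.ramificationIdxIn_eq_ramificationIdx P.asIdeal w.asIdeal (K ≃ₐ[F] K),
        Ideal.ramificationIdx'_eq_ramificationIdx _ _ P.ne_bot]
    have := Fact.mk hp
    obtain ⟨⟨σ, hσ⟩, hord⟩ :=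
      exists_prime_orderOf_dvd_card' (G := w.asIdeal.inertia (K ≃ₐ[F] K)) p (hcard ▸ hdvd)
    refine ⟨σ, by rwa [Subgroup.orderOf_mk] at hord, fun x hx ↦ ?_⟩
    obtain ⟨n, d, hnd⟩ := w.exists_primeCompl_mul_eq_of_integer x hx
    have hin (b : integralClosure A K) :
        w.valuation K (σ (algebraMap _ K b) - algebraMap _ K b) < 1 := by
      rw [← hcomm, ← map_sub, HeightOneSpectrum.valuation_lt_one_iff_mem]
      exact hσ b
    have hd : w.valuation K (algebraMap _ K (d : integralClosure A K)) = 1 :=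
      (HeightOneSpectrum.valuation_eq_one_iff_notMem _).2 d.2
    have hσd : w.valuation K (σ (algebraMap _ K (d : integralClosure A K))) = 1 := by
      rw [← hd]
      exact Valuation.map_eq_of_sub_lt _ (by rw [hd]; exact hin _)
    have key : (σ x - x) * σ (algebraMap _ K (d : integralClosure A K)) =
        (σ (algebraMap _ K n) - algebraMap _ K n) -
          x * (σ (algebraMap _ K (d : integralClosure A K)) - algebraMap _ K d.1) := by
      rw [← hnd, map_mul]; ring
    have h := congrArg (w.valuation K) key
    rw [map_mul, hσd, mul_one] at h
    rw [h]
    refine Valuation.map_sub_lt _ (hin _) ?_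
    rw [map_mul]
    exact (mul_le_of_le_one_left' hx).trans_lt (hin _)

/-- The operator `T + τ^s + T^(q-1) τ^(s+1)`, where `Q = q^s`. -/
def phiOp {K : Type*} [Field K] (T : K) (q Q : ℕ) (x : K) : K :=
  T * x + x ^ Q + T ^ (q - 1) * x ^ (q * Q)

section Valuation

variable {K Γ : Type*} [Field K] [LinearOrderedCommGroupWithZero Γ] {v : Valuation K Γ} {T : K}
  {q Q : ℕ}

theorem phiOp_eq (hq : 1 ≤ q) (x : K) :
    phiOp T q Q x = T * x + x ^ Q * (1 + (T * x ^ Q) ^ (q - 1)) := by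
  obtain ⟨n, rfl⟩ := Nat.exists_eq_add_of_le' hq
  simp only [phiOp, Nat.add_sub_cancel, mul_pow, ← pow_mul]
  ring

theorem valuation_mul_lt_pow (hT : v T < 1) (hQ : 2 ≤ Q) {x : K} (hx : 1 < v x) :
    v (T * x) < v x ^ Q := by
  rw [map_mul]
  calc v T * v x ≤ v x := mul_le_of_le_one_left' hT.le
    _ < v x ^ Q := lt_self_pow₀ hx (by omega)

theorem valuation_phiOp_sub_pow_lt (hq : 2 ≤ q) (hQ : 2 ≤ Q) (hT : v T < 1) {x : K}
    (hx : 1 < v x) (hTx : v T * v x ^ Q < 1) : v (phiOp T q Q x - x ^ Q) < v x ^ Q := by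
  have h : phiOp T q Q x - x ^ Q = T * x + x ^ Q * (T * x ^ Q) ^ (q - 1) := by
    rw [phiOp_eq (by omega)]; ring
  rw [h]
  refine Valuation.map_add_lt _ (valuation_mul_lt_pow hT hQ hx) ?_
  simp only [map_mul, map_pow]
  exact mul_lt_of_lt_one_right (pow_pos (zero_lt_one.trans hx) _)
    (pow_lt_one₀ zero_le hTx (by omega))

theorem valuation_phiOp (hq : 2 ≤ q) (hQ : 2 ≤ Q) (hT : v T < 1) {x : K}
    (hx : 1 < v x) (hTx : v T * v x ^ Q < 1) : v (phiOp T q Q x) = v x ^ Q := by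
  rw [← map_pow]
  refine Valuation.map_eq_of_sub_lt _ ?_
  rw [map_pow]
  exact valuation_phiOp_sub_pow_lt hq hQ hT hx hTx

theorem lt_valuation_phiOp (hq : 2 ≤ q) (hQ : 2 ≤ Q) (hT : v T < 1) {x : K}
    (hx : 1 < v x) (h : v (1 + (T * x ^ Q) ^ (q - 1)) = 1 ∨ 1 < v T * v x ^ Q) :
    v x < v (phiOp T q Q x) := by
  have h1 : 1 ≤ v (1 + (T * x ^ Q) ^ (q - 1)) := by
    rcases h with h | h
    · exact h.ge
    · have h2 : 1 < v ((T * x ^ Q) ^ (q - 1)) := by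
        simp only [map_mul, map_pow]
        exact one_lt_pow₀ h (by omega)
      rw [Valuation.map_add_eq_of_lt_right _ (by rwa [map_one])]
      exact h2.le
  have h3 : v x ^ Q ≤ v (x ^ Q * (1 + (T * x ^ Q) ^ (q - 1))) := by
    rw [map_mul, map_pow]
    exact le_mul_of_one_le_right' h1
  rw [phiOp_eq (by omega), Valuation.map_add_eq_of_lt_right _
    ((valuation_mul_lt_pow hT hQ hx).trans_le h3)]
  exact (lt_self_pow₀ hx (by omega)).trans_le h3

variable {V : AddSubgroup K} [Finite V]

theorem valuation_le_of_stable (hq : 2 ≤ q) (hQ : 2 ≤ Q) (hT : v T < 1)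
    (hV : ∀ x ∈ V, phiOp T q Q x ∈ V) {x : K} (hx : x ∈ V) (hx1 : 1 < v x) :
    v T * v x ^ Q ≤ 1 ∧ (v T * v x ^ Q = 1 → v (1 + (T * x ^ Q) ^ (q - 1)) < 1) := by
  obtain ⟨⟨m, hm⟩, hmax⟩ := Finite.exists_max (fun z : V ↦ v (z : K))
  have hle (z : K) (hz : z ∈ V) (hz1 : 1 < v z) : v T * v z ^ Q ≤ 1 := by
    have hm1 : 1 < v m := hz1.trans_le (hmax ⟨z, hz⟩)
    have : v T * v m ^ Q ≤ 1 := by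
      by_contra! h
      exact (lt_valuation_phiOp hq hQ hT hm1 (.inr h)).not_ge (hmax ⟨_, hV m hm⟩)
    exact (mul_le_mul_right (pow_le_pow_left₀ zero_le (hmax ⟨z, hz⟩) _) _).trans this
  refine ⟨hle x hx hx1, fun heq ↦ ?_⟩
  by_contra! h
  have hz : v ((T * x ^ Q) ^ (q - 1)) = 1 := by simp [heq]
  have h1 : v (1 + (T * x ^ Q) ^ (q - 1)) = 1 :=
    le_antisymm (Valuation.map_add_le _ (map_one v).le hz.le) h
  have hlt := lt_valuation_phiOp hq hQ hT hx1 (.inl h1)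
  refine (hle _ (hV x hx) (hx1.trans hlt)).not_gt ?_
  rw [← heq]
  have hT0 : v T ≠ 0 := by
    intro h0; simp [h0] at heq
  exact mul_lt_mul_of_pos_left (pow_lt_pow_left₀ hlt zero_le (by omega)) (zero_lt_iff.2 hT0)

theorem induction_on_valuation_decreasing (v : Valuation K Γ) {C : K → Prop}
    (h : ∀ x ∈ V, (∀ y ∈ V, v x < v y → C y) → C x) : ∀ x ∈ V, C x := by
  have wf : WellFounded (fun a b : V ↦ v (b : K) < v (a : K)) :=
    @Finite.wellFounded_of_trans_of_irrefl _ _ _ ⟨fun _ _ _ h₁ h₂ ↦ h₂.trans h₁⟩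
      ⟨fun _ ↦ lt_irrefl _⟩
  intro x hx
  exact wf.induction (C := fun z : V ↦ C z) ⟨x, hx⟩
    fun z ih ↦ h z z.2 fun y hy hlt ↦ ih ⟨y, hy⟩ hlt

theorem induction_on_valuation_increasing (v : Valuation K Γ) {C : K → Prop}
    (h : ∀ x ∈ V, (∀ y ∈ V, v y < v x → C y) → C x) : ∀ x ∈ V, C x := by
  have wf : WellFounded (fun a b : V ↦ v (a : K) < v (b : K)) :=
    @Finite.wellFounded_of_trans_of_irrefl _ _ _ ⟨fun _ _ _ h₁ h₂ ↦ h₁.trans h₂⟩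
      ⟨fun _ ↦ lt_irrefl _⟩
  intro x hx
  exact wf.induction (C := fun z : V ↦ C z) ⟨x, hx⟩
    fun z ih ↦ h z z.2 fun y hy hlt ↦ ih ⟨y, hy⟩ hlt

theorem exists_iterate_valuation_eq (hq : 2 ≤ q) (hQ : 2 ≤ Q) (hT : v T < 1)
    (hV : ∀ x ∈ V, phiOp T q Q x ∈ V) : ∀ x ∈ V, 1 < v x →
      ∃ i, v T * (v x ^ Q ^ i) ^ Q = 1 ∧ ∀ j ≤ i, v ((phiOp T q Q)^[j] x) = v x ^ Q ^ j := by
  refine induction_on_valuation_decreasing v fun x hx ih hx1 ↦ ?_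
  rcases (valuation_le_of_stable hq hQ hT hV hx hx1).1.lt_or_eq with hlt | heq
  · have hval := valuation_phiOp hq hQ hT hx1 hlt
    have hgt : v x < v (phiOp T q Q x) := hval ▸ lt_self_pow₀ hx1 (by omega)
    obtain ⟨i, hi, hj⟩ := ih _ (hV x hx) hgt (hx1.trans hgt)
    refine ⟨i + 1, by rwa [hval, ← pow_mul (v x), ← pow_succ'] at hi, fun j hji ↦ ?_⟩
    rcases j with _ | j
    · simp
    · rw [Function.iterate_succ_apply, hj j (by omega), hval, ← pow_mul, ← pow_succ']
  · exact ⟨0, by simpa using heq, fun j hj ↦ by simp [Nat.le_zero.1 hj]⟩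

variable {k : Type*} [Field k] [Fintype k] [Algebra k K]

theorem exists_valuation_sub_smul_lt {s : ℕ} (hcard : Fintype.card k = q) (hs : s ≠ 0)
    (hT : v T < 1) (hk : ∀ c : k, v (algebraMap k K c) ≤ 1)
    (hV : ∀ x ∈ V, phiOp T q (q ^ s) x ∈ V) : ∀ x ∈ V, ∀ y ∈ V, 1 < v x → v y = v x →
      ∃ c : k, v (x - algebraMap k K c * y) < v x := by
  have hq : 2 ≤ q := hcard ▸ Fintype.one_lt_card
  have hQ : 2 ≤ q ^ s := hq.trans (Nat.le_self_pow hs q)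
  obtain ⟨p, hp⟩ := CharP.exists k
  obtain ⟨e, hpp, he⟩ := FiniteField.card k p
  have := Fact.mk hpp
  have : CharP K p := charP_of_injective_algebraMap (algebraMap k K).injective p
  have hfrob (c : k) (x y : K) :
      (x - algebraMap k K c * y) ^ q ^ s = x ^ q ^ s - algebraMap k K c * y ^ q ^ s := by
    have hc : c ^ q ^ s = c := hcard ▸ FiniteField.pow_card_pow s c
    have hqs : q ^ s = p ^ ((e : ℕ) * s) := by rw [← hcard, he, pow_mul]
    nth_rw 1 [hqs]
    rw [sub_pow_char_pow, ← hqs, mul_pow, ← map_pow, hc]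
  have hroot (c : k) (x y : K) (h : v (x ^ q ^ s - algebraMap k K c * y ^ q ^ s) < v x ^ q ^ s) :
      v (x - algebraMap k K c * y) < v x := by
    rw [← hfrob, map_pow] at h
    exact lt_of_pow_lt_pow_left₀ _ zero_le h
  refine induction_on_valuation_decreasing v fun x hx ih y hy hx1 hxy ↦ ?_
  have hy1 : 1 < v y := hxy ▸ hx1
  have hxV := valuation_le_of_stable hq hQ hT hV hx hx1
  have hyV := valuation_le_of_stable hq hQ hT hV hy hy1
  rcases hxV.1.lt_or_eq with hlt | heq
  · have hlty : v T * v y ^ q ^ s < 1 := hxy ▸ hlt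
    have hvx := valuation_phiOp hq hQ hT hx1 hlt
    have hvy := valuation_phiOp hq hQ hT hy1 hlty
    have hgt : v x < v (phiOp T q (q ^ s) x) := hvx ▸ lt_self_pow₀ hx1 (by omega)
    obtain ⟨c, hc⟩ := ih _ (hV x hx) hgt _ (hV y hy) (hx1.trans hgt) (by rw [hvx, hvy, hxy])
    refine ⟨c, hroot c x y ?_⟩
    have h : x ^ q ^ s - algebraMap k K c * y ^ q ^ s =
        (phiOp T q (q ^ s) x - algebraMap k K c * phiOp T q (q ^ s) y) -
        ((phiOp T q (q ^ s) x - x ^ q ^ s) -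
          algebraMap k K c * (phiOp T q (q ^ s) y - y ^ q ^ s)) := by ring
    rw [h]
    refine Valuation.map_sub_lt _ (hvx ▸ hc) (Valuation.map_sub_lt _
      (valuation_phiOp_sub_pow_lt hq hQ hT hx1 hlt) ?_)
    rw [map_mul]
    refine (mul_le_of_le_one_left' (hk c)).trans_lt ?_
    rw [← hxy]
    exact valuation_phiOp_sub_pow_lt hq hQ hT hy1 hlty
  · have hlx := hxV.2 heq
    have hly := hyV.2 (hxy ▸ heq)
    have hvx0 : v x ≠ 0 := (zero_lt_one.trans hx1).ne'
    have hx0 : x ≠ 0 := (Valuation.ne_zero_iff v).1 hvx0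
    have hy0 : y ≠ 0 := (Valuation.ne_zero_iff v).1 (hxy ▸ hvx0)
    have hT0 : T ≠ 0 := by rintro rfl; simp at heq
    set a := T * x ^ q ^ s with ha
    set b := T * y ^ q ^ s with hb
    have hva : v a = 1 := by simpa [ha] using heq
    have hvb : v b = 1 := by simpa [hb, hxy] using heq
    have hb0 : b ≠ 0 := by simp [hb, hT0, hy0]
    have hu : v (a / b) = 1 := by simp [hva, hvb]
    have hlt : v ((a / b) ^ q - a / b) < 1 := by
      have h : (a / b) ^ q - a / b =
          (a / b) * ((1 + a ^ (q - 1)) - (1 + b ^ (q - 1))) / b ^ (q - 1) := by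
        obtain ⟨n, rfl⟩ := Nat.exists_eq_add_of_le' hq
        rw [show n + 2 - 1 = n + 1 by omega, div_pow]
        field_simp
        ring
      rw [h, map_div₀, map_mul, hu, map_pow, hvb, one_mul, one_pow, div_one]
      exact Valuation.map_sub_lt _ hlx hly
    have hprod : (a / b) ^ q - a / b = ∏ c : k, (a / b - algebraMap k K c) := by
      have hmonic : (X ^ q - X : k[X]).Monic :=
        monic_X_pow_sub (by rw [degree_X]; exact_mod_cast (by omega : 1 < q))
      have hroots : (X ^ q - X : k[X]).roots = Finset.univ.val :=
        hcard ▸ FiniteField.roots_X_pow_card_sub_X k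
      have hsplits : (X ^ q - X : k[X]).Splits := by
        rw [splits_iff_card_roots, hroots, FiniteField.X_pow_card_sub_X_natDegree_eq k (by omega)]
        simpa using hcard
      have h := hsplits.eq_prod_roots_of_monic hmonic
      rw [hroots] at h
      simpa [map_prod] using congrArg (aeval (a / b)) h
    obtain ⟨c, -, hc⟩ : ∃ c ∈ Finset.univ, v (a / b - algebraMap k K c) < 1 := by
      by_contra! h
      refine hlt.not_ge ?_
      rw [hprod, map_prod]
      exact Finset.one_le_prod' h
    refine ⟨c, hroot c x y ?_⟩
    have h : x ^ q ^ s - algebraMap k K c * y ^ q ^ s =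
        (a / b - algebraMap k K c) * y ^ q ^ s := by
      rw [ha, hb]; field_simp
    rw [h, map_mul, map_pow, hxy]
    exact mul_lt_of_lt_one_left (pow_pos (zero_lt_iff.2 hvx0) _) hc

theorem exists_generator_modulo_integral {s : ℕ} (hcard : Fintype.card k = q) (hs : s ≠ 0)
    (hT : v T < 1) (hk : ∀ c : k, v (algebraMap k K c) ≤ 1)
    (hV : ∀ x ∈ V, phiOp T q (q ^ s) x ∈ V)
    (hVk : ∀ c : k, ∀ x ∈ V, algebraMap k K c * x ∈ V) (hne : ∃ x ∈ V, 1 < v x) :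
    ∃ x₀ ∈ V, ∃ y ∈ V, v T * v y ^ q ^ s = 1 ∧
      ∀ W : AddSubgroup K, (∀ x ∈ V, v x ≤ 1 → x ∈ W) → x₀ ∈ W →
        (∀ x ∈ W, phiOp T q (q ^ s) x ∈ W) → (∀ c : k, ∀ x ∈ W, algebraMap k K c * x ∈ W) →
        V ≤ W := by
  have hq : 2 ≤ q := hcard ▸ Fintype.one_lt_card
  have hQ : 2 ≤ q ^ s := hq.trans (Nat.le_self_pow hs q)
  obtain ⟨x, hx, hx1⟩ := hne
  have : Nonempty {z : V // 1 < v (z : K)} := ⟨⟨⟨x, hx⟩, hx1⟩⟩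
  obtain ⟨⟨⟨x₀, hx₀⟩, h₀⟩, hmin⟩ :=
    Finite.exists_min (fun z : {z : V // 1 < v (z : K)} ↦ v (z : K))
  obtain ⟨i₀, hi₀, hj₀⟩ := exists_iterate_valuation_eq hq hQ hT hV x₀ hx₀ h₀
  have hiter (S : AddSubgroup K) (hS : ∀ x ∈ S, phiOp T q (q ^ s) x ∈ S) (hxS : x₀ ∈ S) (j : ℕ) :
      (phiOp T q (q ^ s))^[j] x₀ ∈ S := by
    induction j with
    | zero => exact hxS
    | succ j ih => rw [Function.iterate_succ_apply']; exact hS _ ih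
  refine ⟨x₀, hx₀, _, hiter V hV hx₀ i₀, by rw [hj₀ i₀ le_rfl, hi₀], fun W hW hxW hWf hWk ↦ ?_⟩
  refine induction_on_valuation_increasing v fun x hx ih ↦ ?_
  rcases le_or_gt (v x) 1 with hx1 | hx1
  · exact hW x hx hx1
  obtain ⟨i, hi, -⟩ := exists_iterate_valuation_eq hq hQ hT hV x hx hx1
  have hle : v x₀ ≤ v x := hmin ⟨⟨x, hx⟩, hx1⟩
  have hT0 : v T ≠ 0 := by intro h; simp [h] at hi
  have heq : v x₀ ^ (q ^ s) ^ i₀ = v x ^ (q ^ s) ^ i :=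
    (pow_left_inj₀ zero_le zero_le (by omega)).1 (mul_left_cancel₀ hT0 (hi₀.trans hi.symm))
  have hii : i ≤ i₀ := by
    by_contra! h
    refine heq.not_lt (lt_of_le_of_lt (pow_le_pow_left₀ zero_le hle _) ?_)
    exact pow_lt_pow_right₀ hx1 (Nat.pow_lt_pow_right (by omega) h)
  obtain ⟨m, rfl⟩ := Nat.exists_eq_add_of_le' hii
  have hval : v ((phiOp T q (q ^ s))^[m] x₀) = v x := by
    rw [hj₀ m (by omega)]
    rw [pow_add, pow_mul] at heq
    exact (pow_left_inj₀ zero_le zero_le (by positivity)).1 heq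
  obtain ⟨c, hc⟩ := exists_valuation_sub_smul_lt hcard hs hT hk hV x hx _ (hiter V hV hx₀ m) hx1 hval
  have hmem := ih _ (V.sub_mem hx (hVk c _ (hiter V hV hx₀ m))) hc
  simpa using W.add_mem hmem (hWk c _ (hiter W hWf hxW m))

end Valuation

theorem addMonoidEnd_map_mul_apply {A M : Type*} [Semiring A] [AddCommMonoid M]
    (φ : A →+* AddMonoid.End M) (a b : A) (x : M) : φ (a * b) x = φ a (φ b x) := by
  rw [map_mul]; rfl

theorem no_form_invariant_under_transvection {A M k : Type*} [CommRing A] [AddCommGroup M]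
    [Field k] {p : ℕ} (hp : p.Prime) (hp2 : p ≠ 2) [CharP k p] (φ : A →+* AddMonoid.End M)
    (π : A →+* k) (hπ : Function.Surjective π) (l : A) (hker : ∀ a, π a = 0 → l ∣ a)
    (V V₀ : AddSubgroup M) (hV₀V : V₀ ≤ V) (hl : ∀ x ∈ V, φ l x = 0)
    (hφV : ∀ a, ∀ x ∈ V, φ a x ∈ V) (hφV₀ : ∀ a, ∀ x ∈ V₀, φ a x ∈ V₀)
    (σ : M →+ M) (hσV : ∀ x ∈ V, σ x ∈ V) (hσφ : ∀ a, ∀ x ∈ V, σ (φ a x) = φ a (σ x))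
    (hσV₀ : ∀ x ∈ V₀, σ x = x) (hσp : ∀ x ∈ V, σ^[p] x = x) (hσ : ∃ x ∈ V, σ x ≠ x)
    (x₀ : M) (hx₀ : x₀ ∈ V) (hgen : ∀ x ∈ V, ∃ a, ∃ w ∈ V₀, x = φ a x₀ + w)
    (β : M → M → k) (μ : k)
    (hsymm : ∀ v ∈ V, ∀ w ∈ V, β v w = β w v)
    (hadd : ∀ u ∈ V, ∀ v ∈ V, ∀ w ∈ V, β (u + v) w = β u w + β v w)
    (hsmul : ∀ a, ∀ v ∈ V, ∀ w ∈ V, β (φ a v) w = π a * β v w)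
    (hnd : ∀ v ∈ V, (∀ w ∈ V, β v w = 0) → v = 0)
    (hβ : ∀ v ∈ V, ∀ w ∈ V, β (σ v) (σ w) = μ * β v w) : False := by
  have hone (a : A) (ha : π a = 1) (x : M) (hx : x ∈ V) : φ a x = x := by
    obtain ⟨b, hb⟩ := hker (a - 1) (by simp [ha])
    have h : φ (a - 1) x = 0 := by
      rw [hb, mul_comm, addMonoidEnd_map_mul_apply, hl x hx, map_zero]
    rw [map_sub, map_one] at h
    exact sub_eq_zero.1 h
  have hfix {x : M} (h0 : σ x₀ = x₀) (hx : x ∈ V) : σ x = x := by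
    obtain ⟨a, w, hw, rfl⟩ := hgen x hx
    rw [map_add, hσφ a x₀ hx₀, h0, hσV₀ w hw]
  obtain ⟨a, v, hv, hav⟩ := hgen _ (hσV x₀ hx₀)
  have hiter (n : ℕ) : ∃ w ∈ V₀, σ^[n] x₀ = φ (a ^ n) x₀ + w := by
    induction n with
    | zero => exact ⟨0, V₀.zero_mem, by simp⟩
    | succ n ih =>
      obtain ⟨w, hw, h⟩ := ih
      refine ⟨φ (a ^ n) v + w, V₀.add_mem (hφV₀ _ v hv) hw, ?_⟩
      rw [Function.iterate_succ_apply', h, map_add, hσφ _ x₀ hx₀, hσV₀ w hw, hav, map_add,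
        ← addMonoidEnd_map_mul_apply, ← pow_succ, add_assoc]
  have hpa : π (1 - a ^ p) = 0 := by
    by_contra hne
    obtain ⟨w, hw, h⟩ := hiter p
    rw [hσp x₀ hx₀] at h
    obtain ⟨b, hb⟩ := hπ (π (1 - a ^ p))⁻¹
    have hmem : φ (b * (1 - a ^ p)) x₀ ∈ V₀ := by
      rw [addMonoidEnd_map_mul_apply, map_sub, map_one]
      refine hφV₀ _ _ ?_
      have : (1 - φ (a ^ p) : AddMonoid.End M) x₀ = w := sub_eq_of_eq_add' h
      rwa [this]
    rw [hone _ (by rw [map_mul, hb, inv_mul_cancel₀ hne]) x₀ hx₀] at hmem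
    obtain ⟨x, hx, hxσ⟩ := hσ
    exact hxσ (hfix (hσV₀ x₀ hmem) hx)
  have := Fact.mk hp
  have hpow {c : k} (hc : c ^ p = 1) : c = 1 := by
    refine sub_eq_zero.1 (pow_eq_zero_iff hp.ne_zero |>.1 ?_)
    rw [sub_pow_char, hc, one_pow, sub_self]
  have ha1 : π a = 1 := hpow <| by
    rw [map_sub, map_one, map_pow, sub_eq_zero] at hpa
    exact hpa.symm
  rw [hone a ha1 x₀ hx₀] at hav
  have hvV := hV₀V hv
  have hv0 : v ≠ 0 := by
    rintro rfl
    obtain ⟨x, hx, hxσ⟩ := hσ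
    exact hxσ (hfix (by simpa using hav) hx)
  obtain ⟨w, hw, hvw⟩ : ∃ w ∈ V, β v w ≠ 0 := by
    by_contra! h
    exact hv0 (hnd v hvV h)
  have hσn (n : ℕ) (x : M) (hx : x ∈ V) : σ^[n] x ∈ V := by
    induction n with
    | zero => exact hx
    | succ n ih => rw [Function.iterate_succ_apply']; exact hσV _ ih
  have hβn (n : ℕ) : β (σ^[n] v) (σ^[n] w) = μ ^ n * β v w := by
    induction n with
    | zero => simp
    | succ n ih =>
      simp only [Function.iterate_succ_apply']
      rw [hβ _ (hσn n v hvV) _ (hσn n w hw), ih, pow_succ']; ring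
  have hμ : μ = 1 := by
    have h := hβn p
    rw [hσp v hvV, hσp w hw] at h
    exact hpow (mul_right_cancel₀ hvw (by rw [← h, one_mul]))
  have hv₀ (w : M) (hw : w ∈ V₀) : β v w = 0 := by
    have h := hβ x₀ hx₀ w (hV₀V hw)
    rw [hav, hσV₀ w hw, hμ, hadd _ hx₀ _ hvV _ (hV₀V hw)] at h
    linear_combination h
  have hvx₀ : β v x₀ = 0 := by
    have h := hβ x₀ hx₀ x₀ hx₀
    have hmem := V.add_mem hx₀ hvV
    rw [hav, hμ, hadd _ hx₀ _ hvV _ hmem, hsymm _ hx₀ _ hmem, hsymm _ hvV _ hmem,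
      hadd _ hx₀ _ hvV _ hx₀, hadd _ hx₀ _ hvV _ hvV, hv₀ v hv, hsymm _ hx₀ _ hvV] at h
    have h2 : (2 : k) * β v x₀ = 0 := by linear_combination h
    refine (mul_eq_zero.1 h2).resolve_left fun h ↦ ?_
    have : ((2 : ℕ) : k) = 0 := by exact_mod_cast h
    rw [CharP.cast_eq_zero_iff k p] at this
    exact hp2 ((Nat.prime_dvd_prime_iff_eq hp Nat.prime_two).1 this)
  refine hv0 (hnd v hvV fun w hw ↦ ?_)
  obtain ⟨b, u, hu, rfl⟩ := hgen w hw
  rw [hsymm _ hvV _ hw, hadd _ (hφV b x₀ hx₀) _ (hV₀V hu) _ hvV, hsmul b _ hx₀ _ hvV,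
    hsymm _ hx₀ _ hvV, hsymm _ (hV₀V hu) _ hvV, hvx₀, hv₀ u hu, mul_zero, add_zero]

theorem exists_phi_polynomial {Fq : Type} [Field Fq] {q r : ℕ} (hq : 2 ≤ q) (hr : 2 ≤ r)
    (hqFq : (q : Fq) = 0) {φ : Polynomial Fq →+* AddMonoid.End (Kbar Fq)}
    (hφ : IsDrinfeldPhi Fq q r φ) (n : ℕ) : ∀ a : Fq[X], a ≠ 0 → a.natDegree = n →
      ∃ P : Fq[X][X], (∀ x, φ a x = aeval x P) ∧ derivative P = C a ∧
        P.natDegree = (q ^ r) ^ n ∧ (n ≠ 0 → X ∣ P.leadingCoeff) := by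
  have hconst (c : Fq) (x : Kbar Fq) : φ (C c) x = aeval x (C (C c) * X : Fq[X][X]) := by
    rw [hφ.1, map_mul, aeval_C, aeval_X, IsScalarTower.algebraMap_apply Fq[X] (RatFunc Fq),
      RatFunc.algebraMap_C]
  obtain ⟨PX, hPX, hdX, hnX, hlX⟩ : ∃ P : Fq[X][X], (∀ x, φ X x = aeval x P) ∧
      derivative P = C X ∧ P.natDegree = q ^ r ∧ P.leadingCoeff = X ^ (q - 1) := by
    have hpos : 1 < q ^ (r - 1) := Nat.one_lt_pow (by omega) (by omega)
    have hlt : q ^ (r - 1) < q ^ r := Nat.pow_lt_pow_right (by omega) (by omega)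
    have hdeg : (C X * X + X ^ q ^ (r - 1) : Fq[X][X]).natDegree <
        (C (X ^ (q - 1)) * X ^ q ^ r : Fq[X][X]).natDegree := by
      rw [natDegree_C_mul_X_pow _ _ (pow_ne_zero _ X_ne_zero)]
      refine (natDegree_add_le _ _).trans_lt (max_lt ?_ (by simpa using hlt))
      exact (natDegree_C_mul_le _ _).trans_lt (by rw [natDegree_X]; omega)
    have hq0 (m : ℕ) (hm : m ≠ 0) : ((q ^ m : ℕ) : Fq[X][X]) = 0 := by
      have : (q : Fq[X][X]) = 0 := by
        have := congrArg (fun c : Fq ↦ (C (C c) : Fq[X][X])) hqFq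
        simpa using this
      rw [Nat.cast_pow, this, zero_pow hm]
    refine ⟨C X * X + X ^ q ^ (r - 1) + C (X ^ (q - 1)) * X ^ q ^ r, fun x ↦ ?_, ?_, ?_, ?_⟩
    · rw [hφ.2]
      simp [IsScalarTower.algebraMap_apply Fq[X] (RatFunc Fq) (Kbar Fq)]
    · rw [derivative_add, derivative_add, derivative_C_mul, derivative_C_mul, derivative_X_pow,
        derivative_X_pow, derivative_X, C_eq_natCast, C_eq_natCast, hq0 _ (by omega),
        hq0 _ (by omega)]
      simp
    · rw [natDegree_add_eq_right_of_natDegree_lt hdeg,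
        natDegree_C_mul_X_pow _ _ (pow_ne_zero _ X_ne_zero)]
    · rw [leadingCoeff_add_of_degree_lt (degree_lt_degree hdeg), leadingCoeff_C_mul_X_pow]
  induction n with
  | zero =>
    intro a ha hdeg
    obtain ⟨c, rfl⟩ := natDegree_eq_zero.1 hdeg
    have hc : (C c : Fq[X]) ≠ 0 := ha
    exact ⟨C (C c) * X, hconst c, by simp, by simp [natDegree_C_mul_X _ hc], by simp⟩
  | succ n ih =>
    intro a ha hdeg
    have hb : a.divX.natDegree = n := by rw [natDegree_divX_eq_natDegree_tsub_one, hdeg]; simp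
    have hb0 : a.divX ≠ 0 := by
      intro h
      have := divX_mul_X_add a
      rw [h, zero_mul, zero_add] at this
      rw [← this, natDegree_C] at hdeg
      omega
    obtain ⟨P, hP, hdP, hnP, -⟩ := ih _ hb0 hb
    have hqr : 1 < q ^ r := Nat.one_lt_pow (by omega) (by omega)
    have hdeg' : (C (C (a.coeff 0)) * X : Fq[X][X]).natDegree < (PX.comp P).natDegree := by
      rw [natDegree_comp, hnX, hnP, ← pow_succ']
      refine (natDegree_C_mul_le _ _).trans_lt ?_
      rw [natDegree_X]
      exact Nat.one_lt_pow (by omega) hqr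
    refine ⟨C (C (a.coeff 0)) * X + PX.comp P, fun x ↦ ?_, ?_, ?_, fun _ ↦ ?_⟩
    · conv_lhs => rw [← divX_mul_X_add a, mul_comm, map_add]
      change φ (X * a.divX) x + φ (C (a.coeff 0)) x = _
      rw [addMonoidEnd_map_mul_apply, hP, hPX, hconst, map_add, aeval_comp, add_comm]
    · rw [derivative_add, derivative_comp, hdX, hdP, C_comp, ← C_mul, derivative_C_mul,
        derivative_X, mul_one, ← C_add, add_comm, divX_mul_X_add]
    · rw [natDegree_add_eq_right_of_natDegree_lt hdeg', natDegree_comp, hnX, hnP, ← pow_succ']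
    · rw [leadingCoeff_add_of_degree_lt (degree_lt_degree hdeg'), leadingCoeff_comp, hlX]
      · exact dvd_mul_of_dvd_left (dvd_pow_self _ (by omega)) _
      · rw [hnP]; positivity

section Integrality

variable {A K Γ : Type*} [CommRing A] [Field K] [Algebra A K]
  [LinearOrderedCommGroupWithZero Γ] {v : Valuation K Γ}

theorem valuation_aeval_le_one (hA : ∀ a, v (algebraMap A K a) ≤ 1) (g : A[X]) {z : K}
    (hz : v z ≤ 1) : v (aeval z g) ≤ 1 := by
  rw [aeval_eq_sum_range]
  refine v.map_sum_le fun i _ ↦ ?_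
  rw [Algebra.smul_def, map_mul, map_pow]
  exact mul_le_one' (hA _) (pow_le_one' hz i)

theorem valuation_algebraMap_eq_one_of_isUnit (hA : ∀ a, v (algebraMap A K a) ≤ 1) {a : A}
    (ha : IsUnit a) : v (algebraMap A K a) = 1 := by
  obtain ⟨b, hb⟩ := ha.exists_right_inv
  refine (hA a).antisymm ?_
  calc 1 = v (algebraMap A K a) * v (algebraMap A K b) := by
        rw [← map_mul, ← map_mul, hb, map_one, map_one]
    _ ≤ v (algebraMap A K a) * 1 := by gcongr; exact hA b
    _ = _ := mul_one _

theorem valuation_coeff_prod_X_sub_C_le_one (s : Multiset K) (hs : ∀ a ∈ s, v a ≤ 1) (n : ℕ) :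
    v ((s.map (X - C ·)).prod.coeff n) ≤ 1 := by
  induction s using Multiset.induction generalizing n with
  | empty =>
    rw [Multiset.map_zero, Multiset.prod_zero, coeff_one]
    split_ifs <;> simp
  | cons a s ih =>
    have ih := ih fun b hb ↦ hs b (Multiset.mem_cons_of_mem hb)
    have ha := hs a (Multiset.mem_cons_self a s)
    have hmul (m : ℕ) : v (a * (s.map (X - C ·)).prod.coeff m) ≤ 1 := by
      rw [map_mul]; exact mul_le_one' ha (ih m)
    rw [Multiset.map_cons, Multiset.prod_cons, sub_mul, coeff_sub, coeff_C_mul]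
    cases n with
    | zero => simpa using hmul 0
    | succ n =>
      rw [coeff_X_mul]
      exact (v.map_sub _ _).trans (max_le (ih n) (hmul _))

theorem exists_root_one_lt_valuation {P : K[X]} (hP : P.Splits) (hlead : v P.leadingCoeff < 1)
    {n : ℕ} (hn : v (P.coeff n) = 1) : ∃ x ∈ P.roots, 1 < v x := by
  by_contra! h
  have := hP.eq_prod_roots
  rw [this, coeff_C_mul, map_mul] at hn
  exact (mul_lt_one_of_lt_of_le hlead (valuation_coeff_prod_X_sub_C_le_one P.roots h n)).ne hn

end Integrality

theorem exists_field_of_roots {A F L : Type*} [CommRing A] [Field F] [Field L] [Algebra A F]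
    [FaithfulSMul A F] [Algebra F L] [Algebra A L] [IsScalarTower A F L] [IsAlgClosed L] {P : A[X]}
    {l : A} (hl : l ≠ 0) (hP : derivative P = C l) :
    ∃ K : IntermediateField F L, FiniteDimensional F K ∧ IsGalois F K ∧
      K = IntermediateField.adjoin F {x : L | aeval x P = 0} := by
  have hl' : algebraMap A F l ≠ 0 :=
    (map_ne_zero_iff _ (FaithfulSMul.algebraMap_injective A F)).2 hl
  have hder : derivative (P.map (algebraMap A F)) = C (algebraMap A F l) := by
    rw [derivative_map, hP, map_C]
  have hsep : (P.map (algebraMap A F)).Separable := by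
    rw [Polynomial.Separable, hder]
    exact ⟨0, C (algebraMap A F l)⁻¹, by rw [zero_mul, zero_add, ← C_mul, inv_mul_cancel₀ hl', C_1]⟩
  have hne : P.map (algebraMap A F) ≠ 0 := hsep.ne_zero
  have hset : {x : L | aeval x P = 0} = (P.map (algebraMap A F)).rootSet L := by
    ext x
    rw [mem_rootSet, aeval_map_algebraMap]
    exact (and_iff_right hne).symm
  have := IntermediateField.adjoin_rootSet_isSplittingField (K := F) (L := L)
    (p := P.map (algebraMap A F)) (IsAlgClosed.splits _)
  rw [hset]
  exact ⟨_, IsSplittingField.finiteDimensional _ (P.map (algebraMap A F)),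
    IsGalois.of_separable_splitting_field hsep, rfl⟩

theorem eq_zero_of_aeval_eq_zero {A K Γ : Type*} [CommRing A] [Field K] [Algebra A K]
    [LinearOrderedCommGroupWithZero Γ] {v : Valuation K Γ} (hA : ∀ a, v (algebraMap A K a) ≤ 1)
    {P : A[X]} (h0 : P.coeff 0 = 0) (h1 : v (algebraMap A K (P.coeff 1)) = 1) {z : K}
    (hz : v z < 1) (hPz : aeval z P = 0) : z = 0 := by
  have h : aeval z P.divX * z = 0 := by
    rwa [← divX_mul_X_add P, h0, C_0, add_zero, map_mul, aeval_X] at hPz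
  refine (mul_eq_zero.1 h).resolve_left fun h ↦ ?_
  rw [← divX_mul_X_add P.divX, map_add, map_mul, aeval_X, aeval_C, coeff_divX, zero_add] at h
  have h1' : v (algebraMap A K (P.coeff 1)) < 1 := by
    rw [eq_neg_of_add_eq_zero_right h, v.map_neg, map_mul, mul_comm]
    exact mul_lt_one_of_lt_of_le hz (valuation_aeval_le_one hA _ hz.le)
  exact h1'.ne h1

theorem valuation_algebraMap_eq_one_of_monic_irreducible {k K Γ : Type*} [Field k] [Field K]
    [Algebra k[X] K] [LinearOrderedCommGroupWithZero Γ] {v : Valuation K Γ}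
    (hA : ∀ a, v (algebraMap k[X] K a) ≤ 1) (hX : v (algebraMap k[X] K X) < 1) {l : k[X]}
    (hlm : l.Monic) (hl : Irreducible l) (hlX : l ≠ X) : v (algebraMap k[X] K l) = 1 := by
  have h0 : l.coeff 0 ≠ 0 := fun h ↦ hlX <| (eq_of_monic_of_associated monic_X hlm
    (irreducible_X.associated_of_dvd hl (X_dvd_iff.2 h))).symm
  have hC : v (algebraMap k[X] K (C (l.coeff 0))) = 1 :=
    valuation_algebraMap_eq_one_of_isUnit hA (isUnit_C.2 h0.isUnit)
  rw [← divX_mul_X_add l, map_add, ← hC]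
  refine v.map_add_eq_of_lt_right ?_
  rw [hC, map_mul, map_mul, mul_comm]
  exact mul_lt_one_of_lt_of_le hX (hA _)

section Drinfeld

variable {Fq : Type} [Field Fq] {φ : Polynomial Fq →+* AddMonoid.End (Kbar Fq)}

theorem phi_apply_comm (a b : Fq[X]) (x : Kbar Fq) : φ a (φ b x) = φ b (φ a x) := by
  rw [← addMonoidEnd_map_mul_apply, mul_comm, addMonoidEnd_map_mul_apply]

theorem exists_phi_eq_aeval [Fintype Fq] {q r : ℕ} (hcard : Fintype.card Fq = q) (hr : 2 ≤ r)
    (hφ : IsDrinfeldPhi Fq q r φ) (a : Fq[X]) : ∃ P : Fq[X][X], ∀ x, φ a x = aeval x P := by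
  rcases eq_or_ne a 0 with rfl | ha
  · exact ⟨0, fun x ↦ by rw [map_zero, map_zero]; rfl⟩
  · obtain ⟨P, hP, -⟩ := exists_phi_polynomial (hcard ▸ Fintype.one_lt_card) hr
      (by rw [← hcard, Nat.cast_card_eq_zero]) hφ _ a ha rfl
    exact ⟨P, hP⟩

theorem algEquiv_phi_apply [Fintype Fq] {q r : ℕ} (hcard : Fintype.card Fq = q) (hr : 2 ≤ r)
    (hφ : IsDrinfeldPhi Fq q r φ) (σ : Kbar Fq ≃ₐ[RatFunc Fq] Kbar Fq) (a : Fq[X]) (x : Kbar Fq) :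
    σ (φ a x) = φ a (σ x) := by
  obtain ⟨P, hP⟩ := exists_phi_eq_aeval hcard hr hφ a
  rw [hP, hP]
  exact (aeval_algHom_apply (σ.toAlgHom.restrictScalars Fq[X]) x P).symm

theorem exists_inertia_transvection [Fintype Fq] {p q r : ℕ} (hp : p.Prime) (hpq : p ∣ q)
    (hcard : Fintype.card Fq = q) (hr : 2 ≤ r) (hφ : IsDrinfeldPhi Fq q r φ) {l : Fq[X]}
    (hlm : l.Monic) (hl : Irreducible l) (hlX : l ≠ X) :
    ∃ (σ : Kbar Fq ≃ₐ[RatFunc Fq] Kbar Fq) (V₀ : AddSubgroup (Kbar Fq)) (x₀ : Kbar Fq),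
      (∀ x ∈ V₀, φ l x = 0) ∧ (∀ a, ∀ x ∈ V₀, φ a x ∈ V₀) ∧ (∀ x ∈ V₀, σ x = x) ∧
      (∀ x, φ l x = 0 → σ^[p] x = x) ∧ (∃ x, φ l x = 0 ∧ σ x ≠ x) ∧ φ l x₀ = 0 ∧
      ∀ x, φ l x = 0 → ∃ a, ∃ w ∈ V₀, x = φ a x₀ + w := by
  obtain ⟨P, hP, hdP, -, hleadP⟩ := exists_phi_polynomial (hcard ▸ Fintype.one_lt_card) hr
    (by rw [← hcard, Nat.cast_card_eq_zero]) hφ _ l hl.ne_zero rfl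
  have hP0 : P ≠ 0 := by
    rintro rfl
    exact C_ne_zero.2 hl.ne_zero (by rw [← hdP, derivative_zero])
  obtain ⟨K, _, _, hK⟩ := exists_field_of_roots (F := RatFunc Fq) (L := Kbar Fq) hl.ne_zero hdP
  have hmemK {x : Kbar Fq} (hx : φ l x = 0) : x ∈ K := by
    rw [hK]
    exact IntermediateField.subset_adjoin _ _ (show aeval x P = 0 by rwa [← hP])
  have hcoe (x : K) (g : Fq[X][X]) : ((aeval x g : K) : Kbar Fq) = aeval (x : Kbar Fq) g :=
    (aeval_algHom_apply (K.val.restrictScalars Fq[X]) x g).symm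
  have : Finite (Fq[X] ⧸ Ideal.span {(X : Fq[X])}) := by
    have e := (quotientSpanXSubCAlgEquiv (0 : Fq)).toEquiv
    rw [C_0, sub_zero] at e
    exact Finite.of_equiv _ e.symm
  obtain ⟨v, hvA, hvX, hσ⟩ := exists_valuation_and_inertia_element (A := Fq[X]) (F := RatFunc Fq)
    (K := K) X prime_X hp
  have hvl : v (algebraMap Fq[X] K l) = 1 :=
    valuation_algebraMap_eq_one_of_monic_irreducible hvA hvX hlm hl hlX
  let V : AddSubgroup K := (φ l).ker.comap K.val.toRingHom.toAddMonoidHom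
  have hV (x : K) : x ∈ V ↔ φ l (x : Kbar Fq) = 0 := Iff.rfl
  have hVP (x : K) : x ∈ V ↔ aeval x P = 0 := by
    rw [hV, hP, ← hcoe, ZeroMemClass.coe_eq_zero]
  have hinj : Function.Injective (algebraMap Fq[X] K) := by
    rw [IsScalarTower.algebraMap_eq Fq[X] (RatFunc Fq) K]
    exact (algebraMap (RatFunc Fq) K).injective.comp (RatFunc.algebraMap_injective Fq)
  have hPK : P.map (algebraMap Fq[X] K) ≠ 0 := fun h ↦ hP0 <|
    map_injective _ (hinj) (by rw [h, Polynomial.map_zero])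
  have hP1 : P.coeff 1 = l := by simpa [coeff_derivative] using congrArg (coeff · 0) hdP
  have hPc : P.coeff 0 = 0 := by
    have h := (hVP 0).1 V.zero_mem
    rw [← coeff_zero_eq_aeval_zero'] at h
    exact (map_eq_zero_iff _ (hinj)).1 h
  have : Finite V := by
    refine ((P.map (algebraMap Fq[X] K)).rootSet_finite K).subset fun x hx ↦ ?_
    rw [mem_rootSet, aeval_map_algebraMap]
    exact ⟨hPK, (hVP x).1 hx⟩
  have hop (x : K) : φ X (x : Kbar Fq) = (phiOp (algebraMap Fq[X] K X) q (q ^ (r - 1)) x : K) := by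
    have hqr : q * q ^ (r - 1) = q ^ r := by rw [← pow_succ', Nat.sub_add_cancel (by omega)]
    rw [hφ.2, phiOp, hqr]
    rfl
  have hconst (c : Fq) (x : K) : φ (C c) (x : Kbar Fq) = (algebraMap Fq K c * x : K) := by
    rw [hφ.1]
    rfl
  have hVφ (a : Fq[X]) {x : Kbar Fq} (hx : φ l x = 0) : φ a x ∈ K ∧ φ l (φ a x) = 0 := by
    have : φ l (φ a x) = 0 := by rw [phi_apply_comm, hx, map_zero]
    exact ⟨hmemK this, this⟩
  have hne : ∃ x ∈ V, 1 < v x := by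
    have hlead : v (P.map (algebraMap Fq[X] K)).leadingCoeff < 1 := by
      obtain ⟨b, hb⟩ := hleadP hl.natDegree_pos.ne'
      rw [leadingCoeff_map_of_injective (hinj), hb, map_mul,
        map_mul]
      exact mul_lt_one_of_lt_of_le hvX (hvA b)
    have hsplit : (P.map (algebraMap Fq[X] K)).Splits := by
      rw [IsScalarTower.algebraMap_eq Fq[X] (RatFunc Fq) K, ← Polynomial.map_map]
      refine IntermediateField.splits_of_splits (IsAlgClosed.splits _) fun x hx ↦ hmemK ?_
      rw [mem_rootSet, aeval_map_algebraMap] at hx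
      rw [hP, hx.2]
    obtain ⟨x, hx, hvx⟩ := exists_root_one_lt_valuation hsplit hlead
      (n := 1) (by rw [coeff_map, hP1, hvl])
    rw [mem_roots hPK, IsRoot.def, eval_map_algebraMap] at hx
    exact ⟨x, (hVP x).2 hx, hvx⟩
  obtain ⟨x₀, hx₀, y, hy, hvy, hgen⟩ := exists_generator_modulo_integral (v := v) (V := V)
    (T := algebraMap Fq[X] K X) (s := r - 1) hcard (by omega) hvX
    (fun c ↦ by exact hvA (C c))
    (fun x hx ↦ by rw [hV, ← hop]; exact (hVφ X hx).2)
    (fun c x hx ↦ by rw [hV, ← hconst]; exact (hVφ (C c) hx).2) hne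
  obtain ⟨σ, hσp, hσv⟩ := hσ y _ (hpq.trans (dvd_pow_self q (by omega : r - 1 ≠ 0))) hvy
  have hlift (x : K) : σ.liftNormal (Kbar Fq) (x : Kbar Fq) = (σ x : K) :=
    σ.liftNormal_commutes (Kbar Fq) x
  let V₀ : AddSubgroup K := V ⊓ v.integer.toAddSubgroup
  have hV₀φ (a : Fq[X]) (x : K) (hx : x ∈ V₀) :
      ∃ y ∈ V₀, (y : Kbar Fq) = φ a (x : Kbar Fq) := by
    obtain ⟨Q, hQ⟩ := exists_phi_eq_aeval hcard hr hφ a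
    refine ⟨aeval x Q, ⟨?_, valuation_aeval_le_one hvA Q hx.2⟩, by rw [hcoe, hQ]⟩
    change φ l ((aeval x Q : K) : Kbar Fq) = 0
    rw [hcoe, ← hQ]
    exact (hVφ a hx.1).2
  refine ⟨σ.liftNormal (Kbar Fq), V₀.map K.val.toRingHom.toAddMonoidHom, x₀,
    ?_, ?_, ?_, ?_, ?_, hx₀, ?_⟩
  · rintro _ ⟨x, hx, rfl⟩
    exact hx.1
  · rintro a _ ⟨x, hx, rfl⟩
    obtain ⟨y, hy, hyx⟩ := hV₀φ a x hx
    exact ⟨y, hy, hyx⟩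
  · rintro _ ⟨x, hx, rfl⟩
    change σ.liftNormal (Kbar Fq) (x : Kbar Fq) = x
    have hz : σ x - x ∈ V := by
      refine V.sub_mem ?_ hx.1
      rw [hV, ← hlift, ← algEquiv_phi_apply hcard hr hφ, (hV x).1 hx.1, map_zero]
    rw [hlift, ← sub_eq_zero, ← AddSubgroupClass.coe_sub, ZeroMemClass.coe_eq_zero]
    exact eq_zero_of_aeval_eq_zero hvA hPc (by rw [hP1, hvl]) (hσv x hx.2) ((hVP _).1 hz)
  · intro x hx
    have hiter (n : ℕ) (x : K) : (σ.liftNormal (Kbar Fq))^[n] (x : Kbar Fq) = ((σ ^ n) x : K) := by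
      induction n with
      | zero => rfl
      | succ n ih => rw [Function.iterate_succ_apply', ih, hlift, pow_succ']; rfl
    have := hiter p ⟨x, hmemK hx⟩
    rwa [(orderOf_dvd_iff_pow_eq_one.1 hσp.dvd : σ ^ p = 1)] at this
  · by_contra! h
    have hσ1 : σ = 1 := by
      refine AlgEquiv.coe_toAlgHom_injective ?_
      refine IntermediateField.algHom_ext_of_eq_adjoin _ hK fun x hx ↦ Subtype.ext ?_
      exact (hlift _).symm.trans (h x ((hP x).trans hx))
    rw [hσ1, orderOf_one] at hσp
    exact hp.one_lt.ne hσp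
  · intro x hx
    let W : AddSubgroup K :=
      { carrier := {x | ∃ a, ∃ w ∈ V₀, (x : Kbar Fq) = φ a x₀ + w}
        zero_mem' := ⟨0, 0, V₀.zero_mem, by simp⟩
        add_mem' := by
          rintro _ _ ⟨a, w, hw, h⟩ ⟨a', w', hw', h'⟩
          refine ⟨a + a', w + w', V₀.add_mem hw hw', ?_⟩
          rw [map_add]
          change _ = φ a x₀ + φ a' x₀ + (w + w')
          rw [IntermediateField.coe_add, h, h']
          abel
        neg_mem' := by
          rintro _ ⟨a, w, hw, h⟩
          refine ⟨-a, -w, V₀.neg_mem hw, ?_⟩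
          rw [map_neg]
          change _ = -φ a x₀ + -(w : Kbar Fq)
          rw [IntermediateField.coe_neg, h, neg_add] }
    have hWφ (b : Fq[X]) (x y : K) (hx : x ∈ W) (hy : (y : Kbar Fq) = φ b x) : y ∈ W := by
      obtain ⟨a, w, hw, h⟩ := hx
      obtain ⟨w', hw', h'⟩ := hV₀φ b w hw
      exact ⟨b * a, w', hw', by rw [hy, h, map_add, h', addMonoidEnd_map_mul_apply]⟩
    have hW := hgen W (fun x hx hvx ↦ ⟨0, x, ⟨hx, hvx⟩, by simp⟩)
      ⟨1, 0, V₀.zero_mem, by simp⟩ (fun x hx ↦ hWφ X x _ hx (hop x).symm)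
      (fun c x hx ↦ hWφ (C c) x _ hx (hconst c x).symm)
    obtain ⟨a, w, hw, h⟩ := hW (show ⟨x, hmemK hx⟩ ∈ V from hx)
    exact ⟨a, w, ⟨w, hw, rfl⟩, h⟩

end Drinfeld

/-- Assume `p > r!`. For every nonzero prime `𝔩 = (l) ≠ (T)` there is no nondegenerate
symmetric `𝔽_𝔩 = A/𝔩`-bilinear form `β` on `φ[𝔩]` preserved by `Gal(F̄/F)` up to scalar
multiplication. -/
theorem no_invariant_symmetric_bilinear_form
    (p e q r : ℕ) (hp : p.Prime) (hp5 : 5 ≤ p) (he : 0 < e) (hq : q = p ^ e)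
    (hr : r.Prime) (hr3 : 3 ≤ r) (hfac : r.factorial < p)
    (Fq : Type) [Field Fq] [Fintype Fq] (hFq : Fintype.card Fq = q)
    (φ : Polynomial Fq →+* AddMonoid.End (Kbar Fq)) (hφ : IsDrinfeldPhi Fq q r φ)
    (l : Polynomial Fq) (hlm : l.Monic) (hl : Irreducible l) (hlX : l ≠ X) :
    ¬ ∃ (β : Kbar Fq → Kbar Fq → Polynomial Fq ⧸ Ideal.span {l})
        (lam : (Kbar Fq ≃ₐ[RatFunc Fq] Kbar Fq) → Polynomial Fq ⧸ Ideal.span {l}),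
      -- symmetric
      (∀ v ∈ phiTorsion Fq φ l, ∀ w ∈ phiTorsion Fq φ l, β v w = β w v) ∧
      -- biadditive (in the first variable; the second follows by symmetry)
      (∀ u ∈ phiTorsion Fq φ l, ∀ v ∈ phiTorsion Fq φ l, ∀ w ∈ phiTorsion Fq φ l,
        β (u + v) w = β u w + β v w) ∧
      -- 𝔽_𝔩-homogeneous, the scalar action of `A/𝔩` on `φ[𝔩]` being through `φ`
      (∀ b : Polynomial Fq, ∀ v ∈ phiTorsion Fq φ l, ∀ w ∈ phiTorsion Fq φ l,
        β (φ b v) w = Ideal.Quotient.mk (Ideal.span {l}) b * β v w) ∧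
      -- nondegenerate
      (∀ v ∈ phiTorsion Fq φ l, (∀ w ∈ phiTorsion Fq φ l, β v w = 0) → v = 0) ∧
      -- preserved by the Galois action up to the nonzero scalars `lam σ`
      (∀ σ : Kbar Fq ≃ₐ[RatFunc Fq] Kbar Fq, lam σ ≠ 0) ∧
      (∀ σ : Kbar Fq ≃ₐ[RatFunc Fq] Kbar Fq, ∀ v ∈ phiTorsion Fq φ l,
        ∀ w ∈ phiTorsion Fq φ l, β (σ v) (σ w) = lam σ * β v w) := by
  rintro ⟨β, lam, hsymm, hadd, hsmul, hnd, -, hβ⟩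
  have hpq : p ∣ q := hq ▸ dvd_pow_self p he.ne'
  have hr2 : 2 ≤ r := hr.two_le
  obtain ⟨σ, V₀, x₀, hV₀l, hV₀φ, hσV₀, hσp, hσ, hx₀, hgen⟩ :=
    exists_inertia_transvection hp hpq hFq hr2 hφ hlm hl hlX
  have : (Ideal.span {l}).IsMaximal := PrincipalIdealRing.isMaximal_of_irreducible hl
  let : Field (Fq[X] ⧸ Ideal.span {l}) := Ideal.Quotient.field _
  have : Fact p.Prime := ⟨hp⟩
  have : CharP Fq p := by
    refine charP_of_card_eq_prime_pow (f := e) ?_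
    rw [hFq, hq]
  have : CharP (Fq[X] ⧸ Ideal.span {l}) p :=
    charP_of_injective_algebraMap (algebraMap Fq (Fq[X] ⧸ Ideal.span {l})).injective p
  exact no_form_invariant_under_transvection hp (by omega) φ (Ideal.Quotient.mk (Ideal.span {l}))
    Ideal.Quotient.mk_surjective l
    (fun a ha ↦ Ideal.mem_span_singleton.1 (Ideal.Quotient.eq_zero_iff_mem.1 ha))
    (φ l).ker V₀ hV₀l (fun x hx ↦ hx)
    (fun a x (hx : φ l x = 0) ↦ show φ l (φ a x) = 0 by rw [phi_apply_comm, hx, map_zero])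
    hV₀φ σ.toRingEquiv.toAddEquiv.toAddMonoidHom
    (fun x (hx : φ l x = 0) ↦ show φ l (σ x) = 0 by
      rw [← algEquiv_phi_apply hFq hr2 hφ, hx, map_zero])
    (fun a x _ ↦ algEquiv_phi_apply hFq hr2 hφ σ a x) hσV₀ hσp hσ x₀ hx₀ hgen β (lam σ)
    hsymm hadd hsmul hnd (hβ σ)
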